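/- For every binary path P ∈ 𝒫_n with P ≠ 1_n, f(P) = Σ_{Q ∈ [P′, P̃]} f(Q), where the sum is over all paths Q in the interval [P′, P̃] of the lattice 𝒫_n. -/

import Mathlib

/-- A binary path is a list of steps: `true` = upstep `u`, `false` = downstep `d`. -/
abbrev BinPath := List Bool

/-- `ht P k` is the height of the `k`-th point of the path `P` (the point reached
after the first `k` steps). -/
def ht (P : BinPath) (k : ℕ) : ℤ :=
  ((P.take k).map (fun b => if b then (1 : ℤ) else -1)).sum

/-- The lattice order on binary paths of the same length: `P ≤ Q` iff
`hᵢ(P) ≤ hᵢ(Q)` for all `i`. -/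
def pathLe (P Q : BinPath) : Prop :=
  P.length = Q.length ∧ ∀ k, ht P k ≤ ht Q k

def pathLt (P Q : BinPath) : Prop := pathLe P Q ∧ P ≠ Q

/-- The maximum path `1ₙ = uⁿ`. -/
def maxPath (n : ℕ) : BinPath := List.replicate n true

/-- Step `i` (0-based) of `P` is a downstep whose endpoint is a valley, i.e. it is
followed by an upstep or it is the last step of `P`. -/
def isValley (P : BinPath) (i : ℕ) : Prop :=
  i < P.length ∧ P.getD i true = false ∧ P.getD (i + 1) true = true

/-- The number of valleys of `P`. -/
def numValleys (P : BinPath) : ℕ :=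
  ((Finset.range P.length).filter
    (fun i => P.getD i true = false ∧ P.getD (i + 1) true = true)).card

/-- The filling of `P`: every valley of `P` is turned into a peak
(each occurrence `du` whose middle point is a valley becomes `ud`, and a final
valley-`d` becomes `u`). -/
def fill (P : BinPath) : BinPath :=
  List.ofFn (fun i : Fin P.length =>
    if P.get i then P.getD (i.1 - 1) true else P.getD (i.1 + 1) true)

/-- The degree of `P`: the least `k` such that the `k`-fold iterated filling
of `P` is the maximum path. -/
noncomputable def degree (P : BinPath) : ℕ :=
  sInf {k | fill^[k] P = maxPath P.length}

/-- `fPath P` is the number of chains from `P` to the maximum path `1_{|P|}` of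
length `degree P` having small intervals. -/
noncomputable def fPath (P : BinPath) : ℕ :=
  Set.ncard {c : ℕ → BinPath |
    c 0 = P ∧ (∀ i, degree P ≤ i → c i = maxPath P.length) ∧
    ∀ i < degree P, pathLt (c i) (c (i + 1)) ∧ pathLe (c (i + 1)) (fill (c i))}

/-- Height of the lowest valley of `P`. -/
noncomputable def lv (P : BinPath) : ℤ :=
  sInf {h : ℤ | ∃ i, isValley P i ∧ ht P (i + 1) = h}

/-- Height of the highest valley of `P`. -/
noncomputable def hv (P : BinPath) : ℤ :=
  sSup {h : ℤ | ∃ i, isValley P i ∧ ht P (i + 1) = h}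

noncomputable def hvNat (P : BinPath) : ℕ := (hv P).toNat

/-- `P′`: every low valley of `P` is turned into a peak. -/
noncomputable def lowFill (P : BinPath) : BinPath :=
  List.ofFn (fun i : Fin P.length =>
    if P.get i then
      (if P.getD (i.1 - 1) true = false ∧ ht P i.1 = lv P then false else true)
    else
      (if P.getD (i.1 + 1) true = true ∧ ht P (i.1 + 1) = lv P then true else false))

/-- `P*`: every valley of `P` is turned into a peak, except the last one when `P`
ends with a downstep. -/
def starFill (P : BinPath) : BinPath :=
  List.ofFn (fun i : Fin P.length =>
    if i.1 + 1 = P.length ∧ P.get i = false then false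
    else if P.get i then P.getD (i.1 - 1) true else P.getD (i.1 + 1) true)

/-- A Dyck path: starts and ends at height 0 and lies weakly above height 0. -/
def IsDyck (P : BinPath) : Prop := ht P P.length = 0 ∧ ∀ k, 0 ≤ ht P k

/-- A Dyck prefix: a prefix of a Dyck path. -/
def IsDyckPrefix (P : BinPath) : Prop := ∃ Q : BinPath, IsDyck (P ++ Q)

/-- A Dyck suffix: a suffix of a Dyck path. -/
def IsDyckSuffix (P : BinPath) : Prop := ∃ Q : BinPath, IsDyck (Q ++ P)

/-- The pyramid `u^m d^m`. -/
def pyramid (m : ℕ) : BinPath := List.replicate m true ++ List.replicate m false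

/-- Cardinality of the interval `[P, Q]` in the lattice of binary paths. -/
noncomputable def intervalCard (P Q : BinPath) : ℕ :=
  Set.ncard {R : BinPath | pathLe P R ∧ pathLe R Q}

/-- `I(s) = |[s, u^{|s|/2} d^{|s|/2}]|`. -/
noncomputable def Ifun (s : BinPath) : ℕ := intervalCard s (pyramid (s.length / 2))

/-- `J(P) = |[P, u^{|P|}]|`. -/
noncomputable def Jfun (P : BinPath) : ℕ := intervalCard P (maxPath P.length)

/-- `P` and `Q` have exactly the same valleys at every height at most `m`. -/
def sameValleysUpTo (P Q : BinPath) (m : ℤ) : Prop :=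
  ∀ (i : ℕ) (t : ℤ), t ≤ m →
    ((isValley P i ∧ ht P (i + 1) = t) ↔ (isValley Q i ∧ ht Q (i + 1) = t))

/-- A multichain of Dyck paths of type `V` from `a` to `s`: it has length
`h = hv(a)` and for every `j ∈ [h]` its `(j-1)`-st and `j`-th members have the
same valleys at every height at most `h - j`.  (The function `σ` is frozen from
index `h` on, so that such multichains are counted correctly.) -/
def IsVChain (a s : BinPath) (σ : ℕ → BinPath) : Prop :=
  σ 0 = a ∧ (∀ j, hvNat a ≤ j → σ j = s) ∧ (∀ j, IsDyck (σ j)) ∧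
  (∀ j < hvNat a, pathLe (σ j) (σ (j + 1))) ∧
  (∀ j, 1 ≤ j → j ≤ hvNat a →
    sameValleysUpTo (σ (j - 1)) (σ j) ((hvNat a : ℤ) - (j : ℤ)))

/-- `V(a,s)`: the number of `a`–`s` multichains of type `V`. -/
noncomputable def VPath (a s : BinPath) : ℕ :=
  Set.ncard {σ : ℕ → BinPath | IsVChain a s σ}

/-- `ζ^k(P,Q)`: the number of `P`–`Q` multichains of length `k`. -/
noncomputable def zetaPow (k : ℕ) (P Q : BinPath) : ℕ :=
  Set.ncard {c : ℕ → BinPath |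
    c 0 = P ∧ (∀ i, k ≤ i → c i = Q) ∧ ∀ i < k, pathLe (c i) (c (i + 1))}

/-- The join of two paths of the same length (pointwise max of heights). -/
def pathSup (P Q : BinPath) : BinPath :=
  List.ofFn (fun i : Fin P.length =>
    decide (max (ht P i.1) (ht Q i.1) < max (ht P (i.1 + 1)) (ht Q (i.1 + 1))))

/-- The meet of two paths of the same length (pointwise min of heights). -/
def pathInf (P Q : BinPath) : BinPath :=
  List.ofFn (fun i : Fin P.length =>
    decide (min (ht P i.1) (ht Q i.1) < min (ht P (i.1 + 1)) (ht Q (i.1 + 1))))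

/-- `Q` covers `P` in the lattice of binary paths. -/
def pathCovBy (P Q : BinPath) : Prop :=
  pathLt P Q ∧ ∀ R : BinPath, pathLt P R → pathLt R Q → False

/-- `l(P,Q) = (1/2)·Σᵢ (hᵢ(Q) − hᵢ(P))`. -/
def lpq (P Q : BinPath) : ℕ :=
  ((∑ i ∈ Finset.range P.length, (ht Q (i + 1) - ht P (i + 1))) / 2).toNat

/-- Convolution in the incidence algebra of the lattice of binary paths. -/
noncomputable def conv (F G : BinPath → BinPath → ℤ) : BinPath → BinPath → ℤ :=
  fun P Q => ∑ᶠ (R : BinPath) (_ : pathLe P R ∧ pathLe R Q), F P R * G R Q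

/-- The delta function of the incidence algebra. -/
def deltaFun : BinPath → BinPath → ℤ := fun P Q => if P = Q then 1 else 0

/-- `μ^k`: the `k`-th convolution power of `μ` (`μ^0` is the delta function). -/
noncomputable def muPow (mu : BinPath → BinPath → ℤ) (k : ℕ) : BinPath → BinPath → ℤ :=
  (conv mu)^[k] deltaFun

/-- The `k`-th step of `P` contributes `1` or `-1` to the height. -/
theorem ht_succ (P : BinPath) {k : ℕ} (hk : k < P.length) :
    ht P (k + 1) = ht P k + if P.getD k true = true then 1 else -1 := by
  rw [ht, ht, List.take_add_one, List.map_append, List.sum_append]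
  simp [hk]

theorem ht_zero (P : BinPath) : ht P 0 = 0 := by simp [ht]

theorem ht_of_length_le (P : BinPath) {k : ℕ} (hk : P.length ≤ k) :
    ht P k = ht P P.length := by
  simp [ht, List.take_of_length_le hk]

theorem ht_parity (P : BinPath) {k : ℕ} (hk : k ≤ P.length) : ∃ m : ℤ, ht P k = k - 2 * m := by
  induction k with
  | zero => exact ⟨0, by simp [ht_zero]⟩
  | succ k ih =>
    obtain ⟨m, hm⟩ := ih (by omega)
    rw [ht_succ P hk, hm]
    split_ifs
    · exact ⟨m, by push_cast; ring⟩
    · exact ⟨m + 1, by push_cast; ring⟩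

theorem ht_le (P : BinPath) {k : ℕ} (hk : k ≤ P.length) : ht P k ≤ k := by
  induction k with
  | zero => simp [ht_zero]
  | succ k ih =>
    have := ih (by omega)
    rw [ht_succ P hk]
    split_ifs <;> push_cast <;> omega

theorem neg_le_ht (P : BinPath) {k : ℕ} (hk : k ≤ P.length) : -(k : ℤ) ≤ ht P k := by
  induction k with
  | zero => simp [ht_zero]
  | succ k ih =>
    have := ih (by omega)
    rw [ht_succ P hk]
    split_ifs <;> push_cast <;> omega

theorem ht_maxPath {n k : ℕ} (hk : k ≤ n) : ht (maxPath n) k = k := by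
  simp [ht, maxPath, hk]

theorem getD_of_ht_eq (P : BinPath) {k : ℕ} (hk : k ≤ P.length) (h : ht P k = k) :
    ∀ i < k, P.getD i true = true := by
  induction k with
  | zero => simp
  | succ k ih =>
    have h1 := ht_le P (k := k) (by omega)
    rw [ht_succ P hk] at h
    push_cast at h
    split_ifs at h with h2
    · intro i hi
      rcases Nat.lt_succ_iff_lt_or_eq.mp hi with hi | rfl
      · exact ih (by omega) (by omega) i hi
      · exact h2
    · omega

theorem eq_maxPath_of_ht (P : BinPath) (h : ht P P.length = P.length) :
    P = maxPath P.length := by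
  refine List.eq_replicate_iff.mpr ⟨rfl, fun b hb => ?_⟩
  obtain ⟨i, hi, rfl⟩ := List.mem_iff_getElem.mp hb
  have := getD_of_ht_eq P le_rfl h i hi
  simpa [List.getD, hi] using this

/-- Turning into peaks those valleys of `P` whose position satisfies `p` raises exactly the
corresponding points, by `2`. -/
theorem ht_partialFill (P R : BinPath) (p : ℕ → Prop) [DecidablePred p]
    (hR : ∀ i < P.length, R.getD i true =
      if P.getD i true = true then decide (¬ (P.getD (i - 1) true = false ∧ p i))
      else decide (P.getD (i + 1) true = true ∧ p (i + 1)))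
    (hlen : R.length = P.length) {k : ℕ} (hk : k ≤ P.length) :
    ht R k = ht P k +
      if P.getD (k - 1) true = false ∧ P.getD k true = true ∧ p k then 2 else 0 := by
  induction k with
  | zero => simp +contextual [ht_zero]
  | succ k ih =>
    rw [ht_succ R (by omega), ht_succ P hk, ih (by omega), hR k (by omega)]
    simp only [Nat.add_sub_cancel]
    by_cases h1 : P.getD k true = true <;> by_cases h2 : P.getD (k - 1) true = false <;>
      by_cases h3 : P.getD (k + 1) true = true <;> by_cases h4 : p k <;>
      by_cases h5 : p (k + 1) <;> simp [-List.getD_eq_getElem?_getD, h1, h2, h3, h4, h5] <;> omega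

theorem length_fill (P : BinPath) : (fill P).length = P.length := by simp [fill]

theorem length_lowFill (P : BinPath) : (lowFill P).length = P.length := by simp [lowFill]

theorem ht_fill (P : BinPath) {k : ℕ} (hk : k ≤ P.length) :
    ht (fill P) k = ht P k +
      if P.getD (k - 1) true = false ∧ P.getD k true = true then 2 else 0 := by
  have := ht_partialFill P (fill P) (fun _ => True) (fun i hi => ?_) (length_fill P) hk
  · simpa using this
  · simp [fill, hi]

theorem ht_lowFill (P : BinPath) {k : ℕ} (hk : k ≤ P.length) :
    ht (lowFill P) k = ht P k +
      if P.getD (k - 1) true = false ∧ P.getD k true = true ∧ ht P k = lv P then 2 else 0 := by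
  refine ht_partialFill P (lowFill P) (fun j => ht P j = lv P) (fun i hi => ?_)
    (length_lowFill P) hk
  rcases hb : P[i] with _ | _
  · by_cases h1 : P[i + 1]?.getD true = true <;> by_cases h2 : ht P (i + 1) = lv P <;>
      simp [lowFill, hi, hb, h1, h2]
  · by_cases h1 : P[i - 1]?.getD true = true <;> by_cases h2 : ht P i = lv P <;>
      simp [lowFill, hi, hb, h1, h2]

/-- `P` lies weakly above the lowest path with all valleys at height at least `t`. -/
def ValleysAbove (t : ℤ) (P : BinPath) : Prop :=
  ∀ i ≤ P.length, min (i : ℤ) t ≤ ht P i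

theorem ValleysAbove.mono {t : ℤ} {P Q : BinPath} (hP : ValleysAbove t P) (h : pathLe P Q) :
    ValleysAbove t Q :=
  fun i hi => (hP i (h.1 ▸ hi)).trans (h.2 i)

theorem ValleysAbove.anti {s t : ℤ} {P : BinPath} (hP : ValleysAbove t P) (h : s ≤ t) :
    ValleysAbove s P :=
  fun i hi => (min_le_min_left _ h).trans (hP i hi)

/-- A point on the boundary of the region `ValleysAbove t` is a valley of height `t`. -/
theorem ValleysAbove.valley {t : ℤ} {P : BinPath} (hP : ValleysAbove t P) {i : ℕ}
    (hi : i ≤ P.length) (h : ht P i < min (i : ℤ) (t + 1)) :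
    0 < i ∧ P.getD (i - 1) true = false ∧ P.getD i true = true ∧ ht P i = t := by
  have h1 := hP i hi
  have hpos : 0 < i := by
    rcases Nat.eq_zero_or_pos i with rfl | h0
    · rw [ht_zero] at h h1; simp at h h1
    · exact h0
  have ht' : ht P i = t := by omega
  refine ⟨hpos, ?_, ?_, ht'⟩
  · by_contra hu
    obtain ⟨j, rfl⟩ := Nat.exists_eq_succ_of_ne_zero hpos.ne'
    have h2 := ht_succ P (k := j) (by omega)
    have h3 := hP j (by omega)
    simp only [Nat.succ_eq_add_one, Nat.add_sub_cancel, Bool.not_eq_false] at *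
    rw [if_pos hu] at h2
    push_cast at *
    omega
  · by_contra hu
    have hl : i < P.length := by
      by_contra hl
      exact hu (by simp [List.getD, List.getElem?_eq_none (not_lt.mp hl)])
    have h2 := ht_succ P hl
    have h3 := hP (i + 1) hl
    rw [if_neg hu] at h2
    push_cast at *
    omega

theorem isValley.ht_le {P : BinPath} {i : ℕ} (hv : isValley P i) : ht P (i + 1) ≤ i - 1 := by
  have h1 := ht_succ P hv.1
  have h2 := _root_.ht_le P hv.1.le
  rw [hv.2.1] at h1
  simp at h1
  omega

theorem valleysAbove_neg_length (P : BinPath) {t : ℤ} (ht' : t ≤ -(P.length : ℤ)) :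
    ValleysAbove t P := by
  intro i hi
  have := neg_le_ht P hi
  omega

theorem valleysAbove_iff (P : BinPath) (t : ℤ) :
    ValleysAbove t P ↔ ∀ i, isValley P i → t ≤ ht P (i + 1) := by
  constructor
  · intro hP i hv
    have h1 := hP (i + 1) hv.1
    have h2 := hv.ht_le
    push_cast at h1
    omega
  · intro hv
    by_contra hP
    obtain ⟨s, hs, hs'⟩ : ∃ s, ValleysAbove s P ∧ ∀ r, ValleysAbove r P → r ≤ s := by
      refine Int.exists_greatest_of_bdd ⟨t, fun r hr => ?_⟩ ⟨_, valleysAbove_neg_length P le_rfl⟩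
      by_contra hlt
      exact hP (hr.anti (by omega))
    have hst : s < t := by
      by_contra hst
      exact hP (hs.anti (by omega))
    have hns : ¬ ValleysAbove (s + 1) P := fun hc => by have := hs' _ hc; omega
    simp only [ValleysAbove, not_forall, not_le] at hns
    obtain ⟨i, hi, hlt⟩ := hns
    obtain ⟨h0, h1, h2, h3⟩ := hs.valley hi hlt
    obtain ⟨j, rfl⟩ := Nat.exists_eq_succ_of_ne_zero h0.ne'
    have := hv j ⟨hi, h1, h2⟩
    simp only [Nat.succ_eq_add_one] at h3
    omega

theorem valleysAbove_length_sub_one (P : BinPath) :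
    ValleysAbove (P.length - 1) P ↔ P = maxPath P.length := by
  constructor
  · intro hP
    apply eq_maxPath_of_ht
    have h1 := hP _ le_rfl
    have h2 := ht_le P le_rfl
    obtain ⟨m, hm⟩ := ht_parity P le_rfl
    omega
  · intro hP i hi
    rw [hP, ht_maxPath hi]
    exact min_le_left _ _

theorem valleysAbove_fill (P : BinPath) {t : ℤ} (ht' : t ≤ P.length - 2) :
    ValleysAbove (t + 1) (fill P) ↔ ValleysAbove t P := by
  constructor
  · intro hF
    rw [valleysAbove_iff]
    rintro i ⟨hi, hd, hu⟩
    by_contra hlt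
    rcases Nat.lt_or_ge (i + 1) P.length with hl | hl
    · have h1 := ht_succ P hl
      have h2 := hF (i + 1 + 1) (by rw [length_fill]; omega)
      have h3 := isValley.ht_le ⟨hi, hd, hu⟩
      rw [ht_fill P (by omega), if_neg (by simp [-List.getD_eq_getElem?_getD, hu])] at h2
      rw [if_pos hu] at h1
      push_cast at *
      omega
    · have h1 := ht_succ P hi
      have h2 := hF i (by rw [length_fill]; omega)
      rw [ht_fill P (by omega), if_neg (by simp [-List.getD_eq_getElem?_getD, hd])] at h2
      rw [hd] at h1
      simp at h1
      omega
  · intro hP i hi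
    rw [length_fill] at hi
    rw [ht_fill P hi]
    by_cases h : ht P i < min (i : ℤ) (t + 1)
    · obtain ⟨-, h1, h2, h3⟩ := hP.valley hi h
      rw [if_pos ⟨h1, h2⟩]
      omega
    · split_ifs <;> omega

theorem length_fill_iterate (P : BinPath) (k : ℕ) : (fill^[k] P).length = P.length := by
  induction k with
  | zero => rfl
  | succ k ih => rw [Function.iterate_succ_apply', length_fill, ih]

theorem fill_iterate_eq_maxPath (P : BinPath) (k : ℕ) :
    fill^[k] P = maxPath P.length ↔ ValleysAbove (P.length - 1 - k) P := by
  induction k generalizing P with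
  | zero => simp [valleysAbove_length_sub_one]
  | succ k ih =>
    rw [Function.iterate_succ_apply, ← length_fill P, ih, length_fill,
      ← valleysAbove_fill P (by push_cast; omega)]
    congr! 1
    push_cast
    ring

theorem degree_le_iff (P : BinPath) (k : ℕ) :
    degree P ≤ k ↔ ValleysAbove (P.length - 1 - k) P := by
  have hne : {k | fill^[k] P = maxPath P.length}.Nonempty :=
    ⟨2 * P.length, (fill_iterate_eq_maxPath _ _).2
      (valleysAbove_neg_length P (by push_cast; omega))⟩
  constructor
  · intro h
    have := Nat.sInf_mem hne
    exact ((fill_iterate_eq_maxPath _ _).1 this).anti (by unfold degree at h; omega)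
  · intro h
    exact Nat.sInf_le ((fill_iterate_eq_maxPath _ _).2 h)

theorem valleysAbove_iff_le_lv {P : BinPath} (h : P ≠ maxPath P.length) (t : ℤ) :
    ValleysAbove t P ↔ t ≤ lv P := by
  have hne : {h : ℤ | ∃ i, isValley P i ∧ ht P (i + 1) = h}.Nonempty := by
    by_contra hc
    refine h ((valleysAbove_length_sub_one P).1 ((valleysAbove_iff _ _).2 fun i hv => ?_))
    exact (hc ⟨_, i, hv, rfl⟩).elim
  have hbdd : BddBelow {h : ℤ | ∃ i, isValley P i ∧ ht P (i + 1) = h} := by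
    refine ⟨-(P.length : ℤ), ?_⟩
    rintro _ ⟨i, hv, rfl⟩
    exact (valleysAbove_iff P _).1 (valleysAbove_neg_length P le_rfl) i hv
  rw [valleysAbove_iff]
  constructor
  · intro hv
    refine le_csInf hne ?_
    rintro _ ⟨i, hi, rfl⟩
    exact hv i hi
  · intro hl i hi
    exact hl.trans (csInf_le hbdd ⟨i, hi, rfl⟩)

theorem pathLe.trans {P Q R : BinPath} (h : pathLe P Q) (h' : pathLe Q R) : pathLe P R :=
  ⟨h.1.trans h'.1, fun k => (h.2 k).trans (h'.2 k)⟩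

theorem pathLe_of_le_length {P Q : BinPath} (hl : P.length = Q.length)
    (h : ∀ k ≤ P.length, ht P k ≤ ht Q k) : pathLe P Q := by
  refine ⟨hl, fun k => ?_⟩
  rcases le_total k P.length with hk | hk
  · exact h k hk
  · rw [ht_of_length_le P hk, ht_of_length_le Q (hl ▸ hk), ← hl]
    exact h _ le_rfl

theorem pathLe_lowFill (P : BinPath) : pathLe P (lowFill P) := by
  refine pathLe_of_le_length (length_lowFill P).symm fun k hk => ?_
  rw [ht_lowFill P hk]
  split_ifs <;> omega

theorem valleysAbove_lowFill {P : BinPath} (h : P ≠ maxPath P.length) :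
    ValleysAbove (lv P + 1) (lowFill P) := by
  intro i hi
  rw [length_lowFill] at hi
  rw [ht_lowFill P hi]
  by_cases hlt : ht P i < min (i : ℤ) (lv P + 1)
  · obtain ⟨-, h1, h2, h3⟩ := ((valleysAbove_iff_le_lv h _).2 le_rfl).valley hi hlt
    rw [if_pos ⟨h1, h2, h3⟩]
    omega
  · split_ifs <;> omega

theorem lowFill_le_iff {P Q : BinPath} (h : P ≠ maxPath P.length) :
    pathLe (lowFill P) Q ↔ pathLe P Q ∧ ValleysAbove (lv P + 1) Q := by
  constructor
  · exact fun hQ => ⟨(pathLe_lowFill P).trans hQ, (valleysAbove_lowFill h).mono hQ⟩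
  · rintro ⟨hPQ, hQ⟩
    refine pathLe_of_le_length ((length_lowFill P).trans hPQ.1) fun k hk => ?_
    rw [length_lowFill] at hk
    have h1 := hPQ.2 k
    rw [ht_lowFill P hk]
    split_ifs with hv
    · obtain ⟨hd, hu, hl⟩ := hv
      cases k with
      | zero => simp [-List.getD_eq_getElem?_getD, hu] at hd
      | succ j =>
        have h2 := isValley.ht_le (i := j) ⟨hk, hd, hu⟩
        have h3 := hQ (j + 1) (hPQ.1 ▸ hk)
        obtain ⟨a, ha⟩ := ht_parity P hk
        obtain ⟨b, hb⟩ := ht_parity Q (hPQ.1 ▸ hk)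
        push_cast at *
        omega
    · omega

theorem degree_eq {P : BinPath} (h : P ≠ maxPath P.length) :
    (degree P : ℤ) = P.length - 1 - lv P := by
  have h1 := (valleysAbove_iff_le_lv h _).1 ((degree_le_iff P _).1 le_rfl)
  have h2 : lv P < P.length - 1 := by
    by_contra hc
    exact h ((valleysAbove_length_sub_one P).1 ((valleysAbove_iff_le_lv h _).2 (by omega)))
  have h3 := (degree_le_iff P (P.length - 1 - lv P).toNat).2
    ((valleysAbove_iff_le_lv h _).2 (by omega))
  omega

theorem degree_ne_zero {P : BinPath} (h : P ≠ maxPath P.length) : degree P ≠ 0 := fun h0 => by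
  have := (degree_le_iff P 0).1 h0.le
  exact h ((valleysAbove_length_sub_one P).1 (by simpa using this))

/-- The degree drops by at most one along a small interval. -/
theorem degree_le_succ {P Q : BinPath} (h : pathLe Q (fill P)) : degree P ≤ degree Q + 1 := by
  have hlen := h.1
  rw [length_fill] at hlen
  rw [degree_le_iff, ← valleysAbove_fill P (by push_cast; omega)]
  refine (((degree_le_iff Q _).1 le_rfl).mono h).anti ?_
  push_cast
  omega

/-- Among the paths of a small interval, those above `P′` are the ones of smaller degree. -/
theorem lowFill_le_iff_degree {P Q : BinPath} (h : P ≠ maxPath P.length)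
    (hQ : pathLe Q (fill P)) :
    pathLe (lowFill P) Q ↔ pathLe P Q ∧ degree P = degree Q + 1 := by
  rw [lowFill_le_iff h]
  refine and_congr_right fun hPQ => ?_
  have h1 := degree_eq h
  have h2 := degree_le_succ hQ
  have h3 := degree_le_iff Q (degree P - 1)
  have hlen := hPQ.1
  have h4 := degree_ne_zero h
  have h5 : (Q.length : ℤ) - 1 - ((degree P - 1 : ℕ) : ℤ) = lv P + 1 := by omega
  rw [h5] at h3
  rw [← h3]
  omega

/-- The chains counted by `fPath`. -/
def chains (P : BinPath) : Set (ℕ → BinPath) :=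
  {c | c 0 = P ∧ (∀ i, degree P ≤ i → c i = maxPath P.length) ∧
    ∀ i < degree P, pathLt (c i) (c (i + 1)) ∧ pathLe (c (i + 1)) (fill (c i))}

theorem length_of_mem_chains {P : BinPath} {c : ℕ → BinPath} (hc : c ∈ chains P) (i : ℕ) :
    (c i).length = P.length := by
  induction i with
  | zero => rw [hc.1]
  | succ i ih =>
    rcases lt_or_ge i (degree P) with hi | hi
    · rw [← (hc.2.2 i hi).1.1.1, ih]
    · rw [hc.2.1 (i + 1) (by omega)]
      simp [maxPath]

theorem finite_chains (P : BinPath) : (chains P).Finite := by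
  let r : (ℕ → BinPath) → (Fin (degree P) → BinPath) := fun c i => c i
  have hfin : (Set.univ.pi fun _ : Fin (degree P) =>
      {Q : BinPath | Q.length = P.length}).Finite :=
    Set.Finite.pi fun _ => List.finite_length_eq Bool _
  refine Set.Finite.of_finite_image (f := r) (hfin.subset ?_) ?_
  · rintro _ ⟨c, hc, rfl⟩ i -
    exact length_of_mem_chains hc i
  · intro c hc c' hc' heq
    funext i
    rcases lt_or_ge i (degree P) with hi | hi
    · exact congrFun heq ⟨i, hi⟩
    · rw [hc.2.1 i hi, hc'.2.1 i hi]

theorem degree_apply_one_of_mem_chains {P : BinPath} {c : ℕ → BinPath} (hc : c ∈ chains P)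
    (h0 : degree P ≠ 0) : degree P = degree (c 1) + 1 := by
  have hdrop : ∀ k ≤ degree P, degree (c (degree P - k)) ≤ k := by
    intro k
    induction k with
    | zero =>
      intro _
      rw [degree_le_iff, hc.2.1 _ (by omega)]
      have := (valleysAbove_length_sub_one (maxPath P.length)).2 (by simp [maxPath])
      exact this.anti (by omega)
    | succ k ih =>
      intro hk
      have hstep := hc.2.2 (degree P - (k + 1)) (by omega)
      rw [show degree P - (k + 1) + 1 = degree P - k by omega] at hstep
      have := degree_le_succ hstep.2
      have := ih (by omega)
      omega
  have h1 := hdrop (degree P - 1) (by omega)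
  rw [show degree P - (degree P - 1) = 1 by omega] at h1
  have h2 := degree_le_succ (hc.2.2 0 (by omega)).2
  rw [hc.1] at h2
  simp only [zero_add] at h2
  omega

/-- A chain from `P` is a path of `[P′, P̃]` together with a chain starting there. -/
theorem mem_chains_iff {P : BinPath} (h : P ≠ maxPath P.length) (c : ℕ → BinPath) :
    c ∈ chains P ↔ c 0 = P ∧ (pathLe (lowFill P) (c 1) ∧ pathLe (c 1) (fill P)) ∧
      (fun i => c (i + 1)) ∈ chains (c 1) := by
  have h0 := degree_ne_zero h
  constructor
  · intro hc
    have hdeg := degree_apply_one_of_mem_chains hc h0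
    have hstep := hc.2.2 0 (by omega)
    rw [hc.1, zero_add] at hstep
    refine ⟨hc.1, ⟨(lowFill_le_iff_degree h hstep.2).2 ⟨hstep.1.1, hdeg⟩, hstep.2⟩, rfl, ?_, ?_⟩
    · intro i hi
      rw [length_of_mem_chains hc 1]
      exact hc.2.1 (i + 1) (by omega)
    · exact fun i hi => hc.2.2 (i + 1) (by omega)
  · rintro ⟨rfl, ⟨hlow, hfill⟩, hc⟩
    obtain ⟨hle, hdeg⟩ := (lowFill_le_iff_degree h hfill).1 hlow
    refine ⟨rfl, fun i hi => ?_, fun i hi => ?_⟩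
    · obtain ⟨j, rfl⟩ : ∃ j, i = j + 1 := ⟨i - 1, by omega⟩
      rw [hle.1]
      exact hc.2.1 j (by omega)
    · cases i with
      | zero => exact ⟨⟨hle, fun heq => by rw [zero_add] at heq; rw [← heq] at hdeg; omega⟩, hfill⟩
      | succ j => exact hc.2.2 j (by omega)

/-- For every binary path `P ≠ 1ₙ`,
`f(P) = Σ_{Q ∈ [P′, P̃]} f(Q)`. -/
theorem statement9 (P : BinPath) (h : P ≠ maxPath P.length) :
    fPath P
      = ∑ᶠ (Q : BinPath) (_ : pathLe (lowFill P) Q ∧ pathLe Q (fill P)), fPath Q := by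
  have hfin : {Q | pathLe (lowFill P) Q ∧ pathLe Q (fill P)}.Finite :=
    (List.finite_length_eq Bool P.length).subset fun Q hQ => hQ.2.1.trans (length_fill P)
  let prepend : (ℕ → BinPath) → ℕ → BinPath := fun c i => Nat.casesOn i P c
  have hinj : Function.Injective prepend := fun c c' hcc =>
    funext fun i => congrFun hcc (i + 1)
  have hunion : chains P =
      ⋃ Q ∈ {Q | pathLe (lowFill P) Q ∧ pathLe Q (fill P)}, prepend '' chains Q := by
    ext c
    rw [mem_chains_iff h]
    simp only [Set.mem_iUnion, Set.mem_image, Set.mem_ofPred_eq, exists_prop]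
    constructor
    · rintro ⟨rfl, hI, hc⟩
      exact ⟨c 1, hI, _, hc, funext fun i => by cases i <;> rfl⟩
    · rintro ⟨Q, hI, c, hc, rfl⟩
      obtain rfl : c 0 = Q := hc.1
      exact ⟨rfl, hI, hc⟩
  have hdisj : {Q | pathLe (lowFill P) Q ∧ pathLe Q (fill P)}.PairwiseDisjoint
      fun Q => prepend '' chains Q := by
    intro Q _ Q' _ hne
    refine Set.disjoint_left.2 ?_
    rintro _ ⟨c, hc, rfl⟩ ⟨c', hc', heq⟩
    rw [hinj heq] at hc'
    exact hne (hc.1.symm.trans hc'.1)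
  calc fPath P = (chains P).ncard := rfl
    _ = ∑ᶠ Q ∈ {Q | pathLe (lowFill P) Q ∧ pathLe Q (fill P)}, (prepend '' chains Q).ncard := by
      rw [hunion]
      exact hfin.ncard_biUnion (fun Q _ => (finite_chains Q).image _) hdisj
    _ = _ := finsum_congr fun Q => finsum_congr fun _ =>
      Set.ncard_image_of_injective _ hinj
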